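/- (Funano's theorem with explicit constant.) Let d ≥ 2, let Ω₁ ⊆ Ω₂ ⊂ ℝ^d be nonempty bounded convex open sets, and let k ≥ 1. Then μ_k(Ω₁) ≥ (C/d²)·μ_k(Ω₂) with C = 1/92². -/

import Mathlib

open MeasureTheory Real Filter

noncomputable section

/-- Euclidean space `ℝ^d`. -/
abbrev Euc (d : ℕ) := EuclideanSpace ℝ (Fin d)

/-- The Rayleigh quotient of a function `u` on a set `Ω ⊆ ℝ^d`. -/
noncomputable def rayleigh {d : ℕ} (Ω : Set (Euc d)) (u : Euc d → ℝ) : ℝ :=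
  (∫ x in Ω, ‖fderiv ℝ u x‖ ^ 2) / (∫ x in Ω, (u x) ^ 2)

/-- The `k`-th Neumann eigenvalue of `Ω ⊆ ℝ^d`, defined by the variational (min-max)
principle: the infimum, over all subspaces `V` of smooth functions `ℝ^d → ℝ` whose space of
restrictions to `Ω` is `(k+1)`-dimensional, of the supremum of the Rayleigh quotient over
the elements of `V` that are nonzero in `L²(Ω)`. -/
noncomputable def neumannEigenvalue {d : ℕ} (k : ℕ) (Ω : Set (Euc d)) : ℝ :=
  sInf { t : ℝ | ∃ V : Submodule ℝ (Euc d → ℝ),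
    (∀ u ∈ V, ContDiff ℝ (⊤ : ℕ∞) u) ∧
    Module.finrank ℝ (V.map (LinearMap.funLeft ℝ ℝ ((↑) : Ω → Euc d))) = k + 1 ∧
    t = sSup { r : ℝ | ∃ u ∈ V, (0 < ∫ x in Ω, (u x) ^ 2) ∧ r = rayleigh Ω u } }

/-- A nonempty bounded convex open subset of `ℝ^d`. -/
def IsConvexDomain {d : ℕ} (Ω : Set (Euc d)) : Prop :=
  Ω.Nonempty ∧ IsOpen Ω ∧ Bornology.IsBounded Ω ∧ Convex ℝ Ω

/-- The optimal constant `α_{k,d}`: the infimum of `μ_k(Ω₁)/μ_k(Ω₂)` over all pairs of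
nonempty bounded convex open sets `Ω₁ ⊆ Ω₂ ⊂ ℝ^d`. -/
noncomputable def alphaConst (k d : ℕ) : ℝ :=
  sInf { r : ℝ | ∃ Ω₁ Ω₂ : Set (Euc d), IsConvexDomain Ω₁ ∧ IsConvexDomain Ω₂ ∧ Ω₁ ⊆ Ω₂ ∧
    r = neumannEigenvalue k Ω₁ / neumannEigenvalue k Ω₂ }

/-- The Bessel function of the first kind of order `ν` (for `x > 0`). -/
noncomputable def besselJ (ν : ℝ) (x : ℝ) : ℝ :=
  ∑' m : ℕ, ((-1 : ℝ) ^ m / (m.factorial * Real.Gamma (m + ν + 1))) * (x / 2) ^ (2 * (m : ℝ) + ν)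

/-- The first positive zero `j_{ν,1}` of the Bessel function `J_ν`. -/
noncomputable def besselZero1 (ν : ℝ) : ℝ :=
  sInf {x : ℝ | 0 < x ∧ besselJ ν x = 0}

/-- The second positive zero `j_{ν,2}` of the Bessel function `J_ν`. -/
noncomputable def besselZero2 (ν : ℝ) : ℝ :=
  sInf {x : ℝ | besselZero1 ν < x ∧ besselJ ν x = 0}

theorem bm_compact (K L : Set ℝ) (H : Set ℝ) (hK : IsCompact K) (hL : IsCompact L)
    (hK0 : K.Nonempty) (hL0 : L.Nonempty)
    (h : ∀ a ∈ K, ∀ b ∈ L, (2⁻¹ : ℝ) * (a + b) ∈ H) :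
    volume K + volume L ≤ 2 * volume H := by
  set H' : Set ℝ := (fun z => (2⁻¹ : ℝ) * z) ⁻¹' H with hH'
  have hvol : volume H' = 2 * volume H := by
    rw [hH', Real.volume_preimage_mul_left (by norm_num)]
    congr 1
    norm_num
  rw [← hvol]
  obtain ⟨a, haK, ha⟩ := hK.exists_isGreatest hK0
  obtain ⟨b, hbL, hb⟩ := hL.exists_isLeast hL0
  have e1 : volume K = volume ((fun z => z - b) ⁻¹' K) := by
    simp [sub_eq_add_neg, measure_preimage_add_right]
  have e2 : volume L = volume ((fun z => z - a) ⁻¹' L) := by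
    simp [sub_eq_add_neg, measure_preimage_add_right]
  set S := (fun z => z - b) ⁻¹' K
  set T := (fun z => z - a) ⁻¹' L
  have hT : MeasurableSet T := (measurable_id.sub_const a) hL.measurableSet
  have hd : AEDisjoint volume S T := by
    have : S ∩ T ⊆ {a + b} := by
      rintro z ⟨hz1, hz2⟩
      have h1 : z - b ≤ a := ha hz1
      have h2 : b ≤ z - a := hb hz2
      simp only [Set.mem_singleton_iff]
      linarith
    exact measure_mono_null this (by simp)
  rw [e1, e2, ← measure_union₀ hT.nullMeasurableSet hd]
  apply measure_mono
  rintro z (hz | hz)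
  · have := h _ hz b hbL
    simpa [hH'] using this
  · have := h a haK _ hz
    simpa [hH'] using this

theorem bm_one (A B H : Set ℝ) (hA : MeasurableSet A) (hB : MeasurableSet B)
    (hA0 : A.Nonempty) (hB0 : B.Nonempty)
    (h : ∀ a ∈ A, ∀ b ∈ B, (2⁻¹ : ℝ) * (a + b) ∈ H) :
    volume A + volume B ≤ 2 * volume H := by
  obtain ⟨a0, ha0⟩ := hA0
  obtain ⟨b0, hb0⟩ := hB0
  have key : ∀ K ⊆ A, IsCompact K → ∀ L ⊆ B, IsCompact L → volume K + volume L ≤ 2 * volume H := by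
    intro K hKA hK L hLB hL
    calc volume K + volume L ≤ volume (insert a0 K) + volume (insert b0 L) := by
          gcongr <;> exact Set.subset_insert _ _
      _ ≤ _ := bm_compact _ _ H (hK.insert a0) (hL.insert b0) (Set.insert_nonempty _ _)
          (Set.insert_nonempty _ _) (fun a ha b hb =>
            h a (Set.insert_subset ha0 hKA ha) b (Set.insert_subset hb0 hLB hb))
  rw [hA.measure_eq_iSup_isCompact, hB.measure_eq_iSup_isCompact]
  have hne1 : Nonempty {K : Set ℝ // K ⊆ A ∧ IsCompact K} := ⟨⟨∅, by simp, by simp⟩⟩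
  have hne2 : Nonempty {K : Set ℝ // K ⊆ B ∧ IsCompact K} := ⟨⟨∅, by simp, by simp⟩⟩
  have r1 : (⨆ K, ⨆ (_ : K ⊆ A), ⨆ (_ : IsCompact K), volume K)
      = ⨆ K : {K : Set ℝ // K ⊆ A ∧ IsCompact K}, volume K.1 := by
    rw [iSup_subtype]; simp only [iSup_and]
  have r2 : (⨆ K, ⨆ (_ : K ⊆ B), ⨆ (_ : IsCompact K), volume K)
      = ⨆ K : {K : Set ℝ // K ⊆ B ∧ IsCompact K}, volume K.1 := by
    rw [iSup_subtype]; simp only [iSup_and]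
  rw [r1, r2, ENNReal.iSup_add]
  refine iSup_le fun K => ?_
  rw [ENNReal.add_iSup]
  exact iSup_le fun L => key _ K.2.1 K.2.2 _ L.2.1 L.2.2

theorem pl_core (f g h : ℝ → ℝ) (hf : Measurable f) (hg : Measurable g) (hh : Measurable h)
    (f0 : ∀ x, 0 ≤ f x) (g0 : ∀ x, 0 ≤ g x) (h0 : ∀ x, 0 ≤ h x)
    (f1 : ∀ x, f x ≤ 1) (g1 : ∀ x, g x ≤ 1)
    (fs : ∀ t < 1, ∃ x, t < f x) (gs : ∀ t < 1, ∃ x, t < g x)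
    (H : ∀ t x y, 0 < t → t < f x → t < g y → t < h ((2⁻¹ : ℝ) * (x + y))) :
    (∫⁻ x, ENNReal.ofReal (f x)) + (∫⁻ x, ENNReal.ofReal (g x)) ≤
      2 * ∫⁻ x, ENNReal.ofReal (h x) := by
  rw [lintegral_eq_lintegral_meas_lt _ (ae_of_all _ f0) hf.aemeasurable,
    lintegral_eq_lintegral_meas_lt _ (ae_of_all _ g0) hg.aemeasurable,
    lintegral_eq_lintegral_meas_lt _ (ae_of_all _ h0) hh.aemeasurable]
  have anti : ∀ f : ℝ → ℝ, Measurable fun t => volume {a | t < f a} := by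
    intro f
    apply Antitone.measurable
    intro s t hst
    exact measure_mono fun a (ha : t < f a) => lt_of_le_of_lt hst ha
  rw [← lintegral_add_left (anti f), ← lintegral_const_mul _ (anti h)]
  apply setLIntegral_mono ((anti h).const_mul _)
  intro t ht
  by_cases h1 : t < 1
  · exact bm_one _ _ _ (hf measurableSet_Ioi) (hg measurableSet_Ioi) (fs t h1) (gs t h1)
      (fun a ha b hb => H t a b ht ha hb)
  · have e1 : {a | t < f a} = ∅ := by
      ext a; simpa using (f1 a).trans (not_lt.1 h1)
    have e2 : {a | t < g a} = ∅ := by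
      ext a; simpa using (g1 a).trans (not_lt.1 h1)
    simp [e1, e2]

theorem amgm (I J H : ENNReal) (h : I + J ≤ 2 * H) : I * J ≤ H ^ 2 := by
  by_cases hH : H = ⊤
  · simp [hH]
  have hT : 2 * H ≠ ⊤ := ENNReal.mul_ne_top (by simp) hH
  have hI : I ≠ ⊤ := fun e => hT (top_le_iff.1 (by simpa [e] using h))
  have hJ : J ≠ ⊤ := fun e => hT (top_le_iff.1 (by simpa [e] using h))
  lift H to NNReal using hH
  lift I to NNReal using hI
  lift J to NNReal using hJ
  norm_cast at h ⊢
  have h' : (I : ℝ) + J ≤ 2 * H := by exact_mod_cast h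
  have : (I : ℝ) * J ≤ H ^ 2 := by
    nlinarith [sq_nonneg ((I : ℝ) - J), I.2, J.2, H.2, mul_self_le_mul_self (add_nonneg I.2 J.2) h']
  exact_mod_cast this

/-- The (midpoint) Prekopa-Leindler property of a measure space. -/
def PLProp (E : Type) [MeasureSpace E] [AddCommGroup E] [Module ℝ E] : Prop :=
  ∀ f g h : E → ENNReal, Measurable f → Measurable g → Measurable h →
    (∀ x y, f x * g y ≤ h ((2⁻¹ : ℝ) • (x + y)) ^ 2) →
    (∫⁻ x, f x) * (∫⁻ x, g x) ≤ (∫⁻ x, h x) ^ 2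

theorem sup_normalize (f : ℝ → ENNReal) (hf : Measurable f) (N : NNReal) (hN : ∀ x, f x ≤ N)
    (h0 : ∫⁻ x, f x ≠ 0) :
    ∃ (a : ℝ) (f' : ℝ → ℝ), 0 < a ∧ Measurable f' ∧ (∀ x, 0 ≤ f' x) ∧ (∀ x, f' x ≤ 1) ∧
      (∀ t < 1, ∃ x, t < f' x) ∧ ∀ x, f x = ENNReal.ofReal (a * f' x) := by
  set A := ⨆ x, f x with hA
  have hAN : A ≤ N := iSup_le hN
  have hAtop : A ≠ ⊤ := ne_top_of_le_ne_top (by simp) hAN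
  have hA0 : A ≠ 0 := by
    intro e
    apply h0
    have : ∀ x, f x = 0 := fun x => le_zero_iff.1 (e ▸ le_iSup f x)
    simp [this]
  have hfA : ∀ x, f x ≤ A := fun x => le_iSup f x
  have hft : ∀ x, f x ≠ ⊤ := fun x => ne_top_of_le_ne_top hAtop (hfA x)
  have ha : 0 < A.toReal := ENNReal.toReal_pos hA0 hAtop
  refine ⟨A.toReal, fun x => (f x).toReal / A.toReal, ha, ?_, ?_, ?_, ?_, ?_⟩
  · exact hf.ennreal_toReal.div_const _
  · intro x; positivity
  · intro x
    rw [div_le_one ha]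
    exact ENNReal.toReal_mono hAtop (hfA x)
  · intro t ht
    have : ENNReal.ofReal (t * A.toReal) < A := by
      have h1 := (ENNReal.ofReal_lt_ofReal_iff (p := t * A.toReal) ha).2 (by nlinarith)
      rwa [ENNReal.ofReal_toReal hAtop] at h1
    obtain ⟨x, hx⟩ := lt_iSup_iff.1 this
    refine ⟨x, ?_⟩
    rw [lt_div_iff₀ ha]
    exact lt_of_not_ge fun hc => absurd hx (not_lt.2 (by
      rw [← ENNReal.ofReal_toReal (hft x)]
      exact ENNReal.ofReal_le_ofReal hc))
  · intro x
    rw [mul_div_cancel₀ _ ha.ne', ENNReal.ofReal_toReal (hft x)]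

theorem pl_bdd (f g h : ℝ → ENNReal) (hf : Measurable f) (hg : Measurable g) (hh : Measurable h)
    (N : NNReal) (fN : ∀ x, f x ≤ N) (gN : ∀ x, g x ≤ N)
    (H : ∀ x y, f x * g y ≤ h ((2⁻¹ : ℝ) • (x + y)) ^ 2) :
    (∫⁻ x, f x) * (∫⁻ x, g x) ≤ (∫⁻ x, h x) ^ 2 := by
  by_cases hf0 : ∫⁻ x, f x = 0
  · simp [hf0]
  by_cases hg0 : ∫⁻ x, g x = 0
  · simp [hg0]
  obtain ⟨a, f', ha, mf, f0, f1, fs, fe⟩ := sup_normalize f hf N fN hf0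
  obtain ⟨b, g', hb, mg, g0, g1, gs, ge⟩ := sup_normalize g hg N gN hg0
  set c := Real.sqrt (a * b) with hc
  have hcpos : 0 < c := Real.sqrt_pos.2 (by positivity)
  have hc2 : c ^ 2 = a * b := Real.sq_sqrt (by positivity)
  set M : ENNReal := ENNReal.ofReal c
  have hM0 : M ≠ 0 := by simpa [M] using hcpos
  have hMt : M ≠ ⊤ := by simp [M]
  set h' : ℝ → ℝ := fun x => (min (h x) M).toReal / c
  have hmt : ∀ x, min (h x) M ≠ ⊤ := fun x => ne_top_of_le_ne_top hMt (min_le_right _ _)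
  have key := pl_core f' g' h' mf mg ((hh.min measurable_const).ennreal_toReal.div_const c) f0 g0
    (fun x => by positivity) f1 g1 fs gs (by
      intro t x y ht hx hy
      have hH := H x y
      rw [fe, ge] at hH
      set z := (2⁻¹ : ℝ) • (x + y)
      change t < h' z
      simp only [h']
      rw [lt_div_iff₀ hcpos]
      have h2 : ENNReal.ofReal (t * c) < min (h z) M := by
        apply lt_min
        · by_contra hcon
          rw [not_lt] at hcon
          have : ENNReal.ofReal (a * f' x) * ENNReal.ofReal (b * g' y)
              ≤ ENNReal.ofReal (t * c) ^ 2 := hH.trans (by gcongr)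
          rw [← ENNReal.ofReal_mul (by have := f0 x; positivity),
            ← ENNReal.ofReal_pow (by positivity),
            ENNReal.ofReal_le_ofReal_iff (by positivity)] at this
          have e : t * t < f' x * g' y := mul_lt_mul'' hx hy ht.le ht.le
          have : (a * b) * (f' x * g' y) ≤ (a * b) * (t * t) := by nlinarith
          have := le_of_mul_le_mul_left this (by positivity)
          linarith
        · apply (ENNReal.ofReal_lt_ofReal_iff hcpos).2
          have := f1 x
          nlinarith
      exact (ENNReal.ofReal_lt_iff_lt_toReal (by positivity) (hmt z)).1 h2)
  have key2 := amgm _ _ _ key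
  have e1 : ∫⁻ x, f x = ENNReal.ofReal a * ∫⁻ x, ENNReal.ofReal (f' x) := by
    rw [← lintegral_const_mul _ mf.ennreal_ofReal]
    exact lintegral_congr fun x => by rw [fe, ENNReal.ofReal_mul ha.le]
  have e2 : ∫⁻ x, g x = ENNReal.ofReal b * ∫⁻ x, ENNReal.ofReal (g' x) := by
    rw [← lintegral_const_mul _ mg.ennreal_ofReal]
    exact lintegral_congr fun x => by rw [ge, ENNReal.ofReal_mul hb.le]
  have e3 : ENNReal.ofReal c * ∫⁻ x, ENNReal.ofReal (h' x) ≤ ∫⁻ x, h x := by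
    rw [← lintegral_const_mul']
    · apply lintegral_mono
      intro x
      simp only [h']
      rw [← ENNReal.ofReal_mul hcpos.le, mul_div_cancel₀ _ hcpos.ne', ENNReal.ofReal_toReal (hmt x)]
      exact min_le_left _ _
    · simp
  calc (∫⁻ x, f x) * (∫⁻ x, g x)
      = ENNReal.ofReal (c ^ 2) * ((∫⁻ x, ENNReal.ofReal (f' x)) * ∫⁻ x, ENNReal.ofReal (g' x)) := by
        rw [e1, e2, hc2, ENNReal.ofReal_mul ha.le]; ring
    _ ≤ ENNReal.ofReal (c ^ 2) * (∫⁻ x, ENNReal.ofReal (h' x)) ^ 2 := by gcongr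
    _ = (ENNReal.ofReal c * ∫⁻ x, ENNReal.ofReal (h' x)) ^ 2 := by
        rw [mul_pow, ENNReal.ofReal_pow hcpos.le]
    _ ≤ _ := by gcongr

theorem iSup_min_nat (a : ENNReal) : ⨆ n : ℕ, min a (n : ENNReal) = a := by
  rw [← inf_iSup_eq, ENNReal.iSup_natCast]
  simp

theorem pl_real : PLProp ℝ := by
  intro f g h hf hg hh H
  have tr : ∀ f : ℝ → ENNReal, Measurable f →
      ∫⁻ x, f x = ⨆ n : ℕ, ∫⁻ x, min (f x) (n : ENNReal) := by
    intro f hf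
    rw [← lintegral_iSup (fun n => hf.min measurable_const)]
    · exact lintegral_congr fun x => (iSup_min_nat _).symm
    · intro m n hmn x
      have : (m : ENNReal) ≤ n := by exact_mod_cast hmn
      exact min_le_min le_rfl this
  have mono : ∀ f : ℝ → ENNReal, Monotone fun n : ℕ => ∫⁻ x, min (f x) (n : ENNReal) := by
    intro f m n hmn
    have : (m : ENNReal) ≤ n := by exact_mod_cast hmn
    exact lintegral_mono fun x => min_le_min le_rfl this
  rw [tr f hf, tr g hg, ENNReal.iSup_mul]
  refine iSup_le fun m => ?_
  rw [ENNReal.mul_iSup]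
  refine iSup_le fun n => ?_
  calc _ ≤ (∫⁻ x, min (f x) ((max m n : ℕ) : ENNReal)) *
        (∫⁻ x, min (g x) ((max m n : ℕ) : ENNReal)) :=
        mul_le_mul' (mono f (le_max_left _ _)) (mono g (le_max_right _ _))
    _ ≤ _ := pl_bdd _ _ h (hf.min measurable_const) (hg.min measurable_const) hh
        ((max m n : ℕ) : NNReal) (fun x => by rw [ENNReal.coe_natCast]; exact min_le_right _ _)
        (fun x => by rw [ENNReal.coe_natCast]; exact min_le_right _ _)
        (fun x y => (mul_le_mul' (min_le_left _ _) (min_le_left _ _)).trans (H x y))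

theorem pl_prod (A B : Type) [MeasureSpace A] [AddCommGroup A] [Module ℝ A]
    [MeasureSpace B] [AddCommGroup B] [Module ℝ B] [SFinite (volume : Measure A)]
    [SFinite (volume : Measure B)] (hA : PLProp A) (hB : PLProp B) : PLProp (A × B) := by
  intro f g h hf hg hh H
  have e : ∀ f : A × B → ENNReal, Measurable f → ∫⁻ z, f z = ∫⁻ x, ∫⁻ y, f (x, y) := by
    intro f hf
    exact lintegral_prod _ hf.aemeasurable
  rw [e f hf, e g hg, e h hh]
  refine hA _ _ _ hf.lintegral_prod_right' hg.lintegral_prod_right' hh.lintegral_prod_right' ?_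
  intro x x'
  refine hB _ _ _ (hf.comp measurable_prodMk_left) (hg.comp measurable_prodMk_left)
    (hh.comp measurable_prodMk_left) ?_
  intro y y'
  exact H (x, y) (x', y')

theorem pl_transfer (A B : Type) [MeasureSpace A] [AddCommGroup A] [Module ℝ A]
    [MeasureSpace B] [AddCommGroup B] [Module ℝ B] (e : A ≃ᵐ B)
    (he : MeasurePreserving e) (hlin : ∀ x y : A, e ((2⁻¹ : ℝ) • (x + y)) = (2⁻¹ : ℝ) • (e x + e y))
    (hA : PLProp A) : PLProp B := by
  intro f g h hf hg hh H
  rw [← he.lintegral_comp hf, ← he.lintegral_comp hg, ← he.lintegral_comp hh]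
  refine hA _ _ _ (hf.comp e.measurable) (hg.comp e.measurable) (hh.comp e.measurable) ?_
  intro x y
  have := H (e x) (e y)
  rwa [← hlin] at this

theorem pl_pi (n : ℕ) : PLProp (Fin n → ℝ) := by
  induction n with
  | zero =>
    intro f g h hf hg hh H
    rw [Measure.volume_pi_eq_dirac 0]
    have := H 0 0
    simpa [lintegral_dirac] using this
  | succ n ih =>
    refine pl_transfer _ _ (MeasurableEquiv.piFinSuccAbove (fun _ : Fin (n+1) => ℝ) 0).symm
      ((volume_preserving_piFinSuccAbove (fun _ : Fin (n+1) => ℝ) 0).symm) ?_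
      (pl_prod ℝ (Fin n → ℝ) pl_real ih)
    intro x y
    ext i
    refine Fin.cases ?_ (fun j => ?_) i <;> simp [MeasurableEquiv.piFinSuccAbove] <;> ring

theorem pl_euc (n : ℕ) : PLProp (EuclideanSpace ℝ (Fin n)) := by
  refine pl_transfer _ _ (MeasurableEquiv.toLp 2 (Fin n → ℝ))
    (PiLp.volume_preserving_toLp (Fin n)) ?_ (pl_pi n)
  intro x y
  rfl


theorem intOn {d : ℕ} {C : Set (Euc d)} {p : Euc d} {D : ℝ} (hD : C ⊆ Metric.closedBall p D)
    {F : Euc d → ℝ} (hF : Continuous F) : IntegrableOn F C volume :=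
  (hF.continuousOn.integrableOn_compact (isCompact_closedBall p D)).mono_set hD

theorem pl_set {d : ℕ} (C : Set (Euc d)) (hC : MeasurableSet C) (hconv : Convex ℝ C)
    (p : Euc d) (D : ℝ) (hD : C ⊆ Metric.closedBall p D) (F G W : Euc d → ℝ)
    (hF : Continuous F) (hG : Continuous G) (hW : Continuous W)
    (F0 : ∀ x, 0 ≤ F x) (G0 : ∀ x, 0 ≤ G x) (W0 : ∀ x, 0 ≤ W x)
    (H : ∀ x ∈ C, ∀ y ∈ C, F x * G y ≤ W ((2⁻¹ : ℝ) • (x + y)) ^ 2) :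
    (∫ x in C, F x) * (∫ x in C, G x) ≤ (∫ x in C, W x) ^ 2 := by
  have e : ∀ F : Euc d → ℝ, Continuous F → (∀ x, 0 ≤ F x) →
      ∫⁻ x, C.indicator (fun x => ENNReal.ofReal (F x)) x = ENNReal.ofReal (∫ x in C, F x) := by
    intro F hF F0
    rw [lintegral_indicator hC, ofReal_integral_eq_lintegral_ofReal (intOn hD hF) (ae_of_all _ F0)]
  have m : ∀ F : Euc d → ℝ, Continuous F →
      Measurable (C.indicator (fun x => ENNReal.ofReal (F x))) :=
    fun F hF => hF.measurable.ennreal_ofReal.indicator hC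
  have key := pl_euc d _ _ _ (m F hF) (m G hG) (m W hW) (by
    intro x y
    by_cases hx : x ∈ C
    · by_cases hy : y ∈ C
      · have hz : (2⁻¹ : ℝ) • (x + y) ∈ C := by
          rw [smul_add]
          exact hconv hx hy (by norm_num) (by norm_num) (by norm_num)
        rw [Set.indicator_of_mem hx, Set.indicator_of_mem hy, Set.indicator_of_mem hz,
          ← ENNReal.ofReal_mul (F0 x), ← ENNReal.ofReal_pow (W0 _)]
        exact ENNReal.ofReal_le_ofReal (H x hx y hy)
      · simp [Set.indicator_of_notMem hy]
    · simp [Set.indicator_of_notMem hx])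
  rw [e F hF F0, e G hG G0, e W hW W0, ← ENNReal.ofReal_mul (integral_nonneg F0),
    ← ENNReal.ofReal_pow (integral_nonneg W0),
    ENNReal.ofReal_le_ofReal_iff (sq_nonneg _)] at key
  exact key

theorem taylor_bound {d : ℕ} (u : Euc d → ℝ) (hu : ContDiff ℝ 2 u) (p : Euc d) (D : ℝ) :
    ∃ L : ℝ, 0 ≤ L ∧ ∀ x ∈ Metric.closedBall p D, ∀ y ∈ Metric.closedBall p D,
      u x - u y ≤ ‖fderiv ℝ u x‖ * ‖x - y‖ + L * ‖x - y‖ ^ 2 := by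
  have hu1 : ContDiff ℝ 1 (fderiv ℝ u) := hu.fderiv_right (by norm_num)
  have hu2 : Continuous (fderiv ℝ (fderiv ℝ u)) := hu1.continuous_fderiv (by norm_num)
  have hu3 : Continuous fun x => ‖fderiv ℝ (fderiv ℝ u) x‖ := by
    exact Continuous.norm (E := Euc d →L[ℝ] Euc d →L[ℝ] ℝ) hu2
  obtain ⟨L, hL'⟩ := (isCompact_closedBall p D).exists_bound_of_continuousOn
    (f := fun x => ‖fderiv ℝ (fderiv ℝ u) x‖) hu3.continuousOn
  have hL : ∀ x ∈ Metric.closedBall p D, ‖fderiv ℝ (fderiv ℝ u) x‖ ≤ L := fun x hx =>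
    (le_abs_self _).trans (hL' x hx)
  have hdu : Differentiable ℝ u := hu.differentiable (by norm_num)
  have hddu : Differentiable ℝ (fderiv ℝ u) := hu1.differentiable (by norm_num)
  refine ⟨max L 0, le_max_right _ _, ?_⟩
  intro x hx y hy
  have hseg : segment ℝ x y ⊆ Metric.closedBall p D :=
    (convex_closedBall p D).segment_subset hx hy
  have h1 : ∀ z ∈ segment ℝ x y, ‖fderiv ℝ u z - fderiv ℝ u x‖ ≤ max L 0 * ‖x - y‖ := by
    intro z hz
    have := (convex_closedBall p D).norm_image_sub_le_of_norm_fderiv_le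
      (f := fderiv ℝ u) (C := max L 0) (fun w _ => hddu w)
      (fun w hw => (hL w hw).trans (le_max_left _ _)) hx (hseg hz)
    refine this.trans ?_
    gcongr
    rw [← dist_eq_norm, ← dist_eq_norm, dist_comm z x]
    have := dist_add_dist_of_mem_segment hz
    have := dist_nonneg (x := z) (y := y)
    linarith
  have h2 := (convex_segment x y).norm_image_sub_le_of_norm_fderiv_le' (f := u)
    (φ := fderiv ℝ u x) (fun w _ => hdu w) h1 (left_mem_segment ℝ x y) (right_mem_segment ℝ x y)
  have h3 := (abs_le.1 (by simpa using h2)).1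
  have h4 : fderiv ℝ u x (x - y) ≤ ‖fderiv ℝ u x‖ * ‖x - y‖ :=
    (le_abs_self _).trans ((fderiv ℝ u x).le_opNorm _)
  rw [map_sub] at h4
  rw [norm_sub_rev y x] at h3
  nlinarith

theorem exp_quad (z : ℝ) (hz : -1 ≤ z) : 1 + z + z ^ 2 / 4 ≤ Real.exp z := by
  have h := Real.add_one_le_exp (z / 2)
  have e : Real.exp z = Real.exp (z / 2) * Real.exp (z / 2) := by rw [← Real.exp_add]; ring_nf
  rw [e]
  nlinarith

/-- Gaussian weight. -/
def gw {d : ℕ} (p : Euc d) (s : ℝ) (x : Euc d) : ℝ := Real.exp (-(‖x - p‖ ^ 2 / (2 * s)))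

theorem gw_cont {d : ℕ} (p : Euc d) (s : ℝ) : Continuous (gw p s) := by
  unfold gw; fun_prop

theorem gw_pos {d : ℕ} (p : Euc d) (s : ℝ) (x : Euc d) : 0 < gw p s x := Real.exp_pos _

theorem gw_mid {d : ℕ} (p : Euc d) (s : ℝ) (hs : 0 < s) (x y : Euc d) :
    gw p s x * gw p s y * Real.exp (‖x - y‖ ^ 2 / (4 * s)) = gw p s ((2⁻¹ : ℝ) • (x + y)) ^ 2 := by
  unfold gw
  rw [← Real.exp_add, ← Real.exp_add, ← Real.exp_nat_mul]
  congr 1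
  have h := parallelogram_law_with_norm ℝ (x - p) (y - p)
  have e1 : (x - p) - (y - p) = x - y := by abel
  have e2 : (x - p) + (y - p) = (2 : ℝ) • ((2⁻¹ : ℝ) • (x + y) - p) := by
    rw [smul_sub, smul_smul]; norm_num [two_smul]; abel
  rw [e1, e2, norm_smul, Real.norm_ofNat] at h
  set m := (2⁻¹ : ℝ) • (x + y) - p
  have : ‖x - p‖ ^ 2 + ‖y - p‖ ^ 2 = 2 * ‖m‖ ^ 2 + ‖x - y‖ ^ 2 / 2 := by nlinarith
  have e3 : ‖y - p‖ ^ 2 = 2 * ‖m‖ ^ 2 + ‖x - y‖ ^ 2 / 2 - ‖x - p‖ ^ 2 := by linarith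
  rw [e3]
  field_simp
  push_cast
  ring

theorem poincare_gauss {d : ℕ} (C : Set (Euc d)) (hC : MeasurableSet C) (hconv : Convex ℝ C)
    (p : Euc d) (D : ℝ) (hD : C ⊆ Metric.closedBall p D) (s : ℝ) (hs : 0 < s)
    (u : Euc d → ℝ) (hu : ContDiff ℝ 2 u) (hmean : ∫ x in C, u x * gw p s x = 0)
    (hW : 0 < ∫ x in C, gw p s x) :
    ∫ x in C, u x ^ 2 * gw p s x ≤ 8 * s * ∫ x in C, ‖fderiv ℝ u x‖ ^ 2 * gw p s x := by
  have hcu : Continuous u := hu.continuous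
  have hcg : Continuous (fderiv ℝ u) := hu.continuous_fderiv (by norm_num)
  have hcw : Continuous (gw p s) := gw_cont p s
  obtain ⟨L, hL0, hL⟩ := taylor_bound u hu p D
  obtain ⟨M, hM⟩ := (isCompact_closedBall p D).exists_bound_of_continuousOn hcu.continuousOn
  set W := ∫ x in C, gw p s x
  set Q := ∫ x in C, u x ^ 2 * gw p s x
  set G := ∫ x in C, ‖fderiv ℝ u x‖ ^ 2 * gw p s x
  have hQ : 0 ≤ Q := integral_nonneg fun x => mul_nonneg (sq_nonneg _) (gw_pos p s x).le
  have hG : 0 ≤ G := integral_nonneg fun x => mul_nonneg (sq_nonneg _) (gw_pos p s x).le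
  have key : ∀ ε : ℝ, 0 < ε → ε * L ≤ 1 / (8 * s) → ε * M ≤ 1 →
      W * (Q / 4 - 2 * s * G) ≤ ε ^ 2 * (s * G * Q / 2) := by
    intro ε hε h1 h2
    set a : Euc d → ℝ := fun x => ε * u x - 2 * s * ε ^ 2 * ‖fderiv ℝ u x‖ ^ 2 with ha
    set b : Euc d → ℝ := fun x => -(ε * u x) with hb
    have hca : Continuous a := by fun_prop
    have hcb : Continuous b := by fun_prop
    have PL := pl_set C hC hconv p D hD (fun x => Real.exp (a x) * gw p s x)
      (fun x => Real.exp (b x) * gw p s x) (gw p s) (by fun_prop) (by fun_prop) hcw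
      (fun x => mul_nonneg (Real.exp_pos _).le (gw_pos p s x).le)
      (fun x => mul_nonneg (Real.exp_pos _).le (gw_pos p s x).le)
      (fun x => (gw_pos p s x).le) (by
        intro x hx y hy
        rw [← gw_mid p s hs]
        have hxy := hL x (hD hx) y (hD hy)
        set r := ‖x - y‖
        set g := ‖fderiv ℝ u x‖ with hg
        have hab : a x + b y ≤ r ^ 2 / (4 * s) := by
          simp only [ha, hb, ← hg]
          have t1 : ε * (u x - u y) ≤ ε * (g * r + L * r ^ 2) := by gcongr
          have t2 : ε * L * r ^ 2 ≤ 1 / (8 * s) * r ^ 2 := by gcongr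
          have t3 : ε * g * r ≤ 2 * s * ε ^ 2 * g ^ 2 + r ^ 2 / (8 * s) := by
            have : 0 ≤ (4 * s * ε * g - r) ^ 2 / (8 * s) := by positivity
            have e : (4 * s * ε * g - r) ^ 2 / (8 * s)
                = 2 * s * ε ^ 2 * g ^ 2 + r ^ 2 / (8 * s) - ε * g * r := by
              field_simp; ring
            linarith
          have t4 : r ^ 2 / (4 * s) = 1 / (8 * s) * r ^ 2 + r ^ 2 / (8 * s) := by
            field_simp; ring
          rw [t4]
          nlinarith
        calc Real.exp (a x) * gw p s x * (Real.exp (b y) * gw p s y)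
            = gw p s x * gw p s y * Real.exp (a x + b y) := by rw [Real.exp_add]; ring
          _ ≤ _ := by
            have := gw_pos p s x
            have := gw_pos p s y
            gcongr)
    have i1 : IntegrableOn (fun x => gw p s x) C volume := intOn hD hcw
    have i2 : IntegrableOn (fun x => u x * gw p s x) C volume := intOn hD (by fun_prop)
    have i3 : IntegrableOn (fun x => u x ^ 2 * gw p s x) C volume := intOn hD (by fun_prop)
    have i4 : IntegrableOn (fun x => ‖fderiv ℝ u x‖ ^ 2 * gw p s x) C volume :=
      intOn hD (by fun_prop)
    have i12 : IntegrableOn (fun x => gw p s x + ε * (u x * gw p s x)) C volume :=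
      intOn hD (by fun_prop)
    have i12' : IntegrableOn (fun x => gw p s x - ε * (u x * gw p s x)) C volume :=
      intOn hD (by fun_prop)
    have X : W - 2 * s * ε ^ 2 * G ≤ ∫ x in C, Real.exp (a x) * gw p s x := by
      have e : W - 2 * s * ε ^ 2 * G = ∫ x in C, (gw p s x + ε * (u x * gw p s x)
          - 2 * s * ε ^ 2 * (‖fderiv ℝ u x‖ ^ 2 * gw p s x)) := by
        rw [integral_sub i12 (i4.const_mul _),
          integral_add i1 (i2.const_mul _), integral_const_mul, integral_const_mul, hmean]
        ring
      rw [e]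
      apply setIntegral_mono_on _ (intOn hD (by fun_prop)) hC
      · intro x _
        have := Real.add_one_le_exp (a x)
        have hp := gw_pos p s x
        simp only [ha] at this ⊢
        nlinarith
      · exact (i1.add (i2.const_mul _)).sub (i4.const_mul _)
    have Y : W + ε ^ 2 * Q / 4 ≤ ∫ x in C, Real.exp (b x) * gw p s x := by
      have e : W + ε ^ 2 * Q / 4 = ∫ x in C, (gw p s x - ε * (u x * gw p s x)
          + ε ^ 2 / 4 * (u x ^ 2 * gw p s x)) := by
        rw [integral_add i12' (i3.const_mul _),
          integral_sub i1 (i2.const_mul _), integral_const_mul, integral_const_mul, hmean]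
        ring
      rw [e]
      apply setIntegral_mono_on _ (intOn hD (by fun_prop)) hC
      · intro x hx
        have hux := (abs_le.1 (by simpa using hM x (hD hx))).2
        have := exp_quad (b x) (by
          simp only [hb]
          nlinarith)
        have hp := gw_pos p s x
        simp only [hb] at this ⊢
        nlinarith
      · exact (i1.sub (i2.const_mul _)).add (i3.const_mul _)
    have A0 : 0 ≤ ∫ x in C, Real.exp (a x) * gw p s x :=
      integral_nonneg fun x => mul_nonneg (Real.exp_pos _).le (gw_pos p s x).le
    have Y0 : 0 ≤ W + ε ^ 2 * Q / 4 := by positivity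
    have fin : (W - 2 * s * ε ^ 2 * G) * (W + ε ^ 2 * Q / 4) ≤ W ^ 2 :=
      (mul_le_mul_of_nonneg_right X Y0).trans ((mul_le_mul_of_nonneg_left Y A0).trans PL)
    have : ε ^ 2 * (W * (Q / 4 - 2 * s * G)) ≤ ε ^ 2 * (ε ^ 2 * (s * G * Q / 2)) := by nlinarith
    exact le_of_mul_le_mul_left this (by positivity)
  have lim : W * (Q / 4 - 2 * s * G) ≤ 0 := by
    have t : Tendsto (fun ε : ℝ => ε ^ 2 * (s * G * Q / 2)) (nhdsWithin 0 (Set.Ioi 0)) (nhds 0) := by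
      have : Continuous (fun ε : ℝ => ε ^ 2 * (s * G * Q / 2)) := by fun_prop
      have := this.tendsto 0
      simp only [ne_eq, OfNat.ofNat_ne_zero, not_false_eq_true, zero_pow, zero_mul] at this
      exact this.mono_left nhdsWithin_le_nhds
    refine ge_of_tendsto t ?_
    have c1 : ∀ᶠ ε : ℝ in nhdsWithin 0 (Set.Ioi 0), ε * L ≤ 1 / (8 * s) := by
      apply nhdsWithin_le_nhds
      have : ContinuousAt (fun ε : ℝ => ε * L) 0 := by fun_prop
      have h0 : (fun ε : ℝ => ε * L) 0 < 1 / (8 * s) := by simp; positivity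
      exact (this.eventually_lt continuousAt_const h0).mono fun _ h => h.le
    have c2 : ∀ᶠ ε : ℝ in nhdsWithin 0 (Set.Ioi 0), ε * M ≤ 1 := by
      apply nhdsWithin_le_nhds
      have : ContinuousAt (fun ε : ℝ => ε * M) 0 := by fun_prop
      have h0 : (fun ε : ℝ => ε * M) 0 < 1 := by simp
      exact (this.eventually_lt continuousAt_const h0).mono fun _ h => h.le
    filter_upwards [c1, c2, self_mem_nhdsWithin] with ε h1 h2 h3
    exact key ε h3 h1 h2
  have : Q / 4 - 2 * s * G ≤ 0 := by
    by_contra hc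
    push Not at hc
    have := mul_pos hW hc
    linarith
  linarith

theorem poincare {d : ℕ} (C : Set (Euc d)) (hC : MeasurableSet C) (hconv : Convex ℝ C)
    (p : Euc d) (D : ℝ) (hD0 : 0 < D) (hD : C ⊆ Metric.closedBall p D)
    (u : Euc d → ℝ) (hu : ContDiff ℝ 2 u) (hmean : ∫ x in C, u x * gw p (D ^ 2) x = 0) :
    ∫ x in C, u x ^ 2 ≤ 16 * D ^ 2 * ∫ x in C, ‖fderiv ℝ u x‖ ^ 2 := by
  have hcu : Continuous u := hu.continuous
  have hcg : Continuous (fderiv ℝ u) := hu.continuous_fderiv (by norm_num)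
  have hcw : Continuous (gw p (D ^ 2)) := gw_cont p _
  by_cases hv : volume C = 0
  · simp [Measure.restrict_eq_zero.2 hv]
  have hW : 0 < ∫ x in C, gw p (D ^ 2) x := by
    rw [integral_pos_iff_support_of_nonneg (fun x => (gw_pos p _ x).le) (intOn hD hcw)]
    have : Function.support (gw p (D ^ 2)) = Set.univ := by
      ext x; simp [(gw_pos p (D ^ 2) x).ne']
    rw [this]
    simpa using pos_iff_ne_zero.2 hv
  have key := poincare_gauss C hC hconv p D hD (D ^ 2) (by positivity) u hu hmean hW
  have lo : ∀ x ∈ C, 1 / 2 ≤ gw p (D ^ 2) x := by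
    intro x hx
    have h1 : ‖x - p‖ ≤ D := by simpa [dist_eq_norm] using hD hx
    have h2 : ‖x - p‖ ^ 2 / (2 * D ^ 2) ≤ 1 / 2 := by
      rw [div_le_iff₀ (by positivity)]
      nlinarith [norm_nonneg (x - p)]
    have := Real.add_one_le_exp (-(‖x - p‖ ^ 2 / (2 * D ^ 2)))
    unfold gw
    linarith
  have hi : ∀ x, gw p (D ^ 2) x ≤ 1 := by
    intro x
    unfold gw
    rw [Real.exp_le_one_iff]
    have : 0 ≤ ‖x - p‖ ^ 2 / (2 * D ^ 2) := by positivity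
    linarith
  have b1 : (1 / 2) * ∫ x in C, u x ^ 2 ≤ ∫ x in C, u x ^ 2 * gw p (D ^ 2) x := by
    rw [← integral_const_mul]
    apply setIntegral_mono_on (intOn hD (by fun_prop)) (intOn hD (by fun_prop)) hC
    intro x hx
    nlinarith [lo x hx, sq_nonneg (u x)]
  have b2 : ∫ x in C, ‖fderiv ℝ u x‖ ^ 2 * gw p (D ^ 2) x ≤ ∫ x in C, ‖fderiv ℝ u x‖ ^ 2 := by
    apply setIntegral_mono_on (intOn hD (by fun_prop)) (intOn hD (by fun_prop)) hC
    intro x hx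
    nlinarith [hi x, sq_nonneg (‖fderiv ℝ u x‖)]
  have : 8 * D ^ 2 * ∫ x in C, ‖fderiv ℝ u x‖ ^ 2 * gw p (D ^ 2) x ≤
      8 * D ^ 2 * ∫ x in C, ‖fderiv ℝ u x‖ ^ 2 := by gcongr
  linarith


theorem cutoff_exists (a b : ℝ) (hab : a < b) :
    ∃ η : ℝ → ℝ, ContDiff ℝ (⊤ : ℕ∞) η ∧ (∀ t ≤ a, η t = 1) ∧ (∀ t, b ≤ t → η t = 0) ∧
      (∀ t, b ≤ t → deriv η t = 0) ∧ ∀ t, |deriv η t| ≤ (4 / 3) / (b - a) := by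
  have hba : 0 < b - a := sub_pos.2 hab
  let φ : ContDiffBump ((a + b) / 2 : ℝ) :=
    { rIn := 3 / 4 * ((b - a) / 2), rOut := (b - a) / 2, rIn_pos := by positivity,
      rIn_lt_rOut := by linarith }
  set ψ : ℝ → ℝ := φ.normed volume with hψ
  have hψc : Continuous ψ := φ.continuous_normed
  have hψ0 : ∀ t, t ∉ Set.Ioo a b → ψ t = 0 := by
    intro t ht
    have h1 : t ∉ Function.support ψ := by
      rw [hψ, φ.support_normed_eq]
      change t ∉ Metric.ball ((a + b) / 2) ((b - a) / 2)
      rw [Real.ball_eq_Ioo]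
      convert ht using 2
      congr 1 <;> ring
    simpa using h1
  have hη : ∀ t, HasDerivAt (fun t => 1 - ∫ x in a..t, ψ x) (-ψ t) t := by
    intro t
    exact (intervalIntegral.integral_hasDerivAt_right (hψc.intervalIntegrable _ _)
      (hψc.stronglyMeasurableAtFilter _ _) hψc.continuousAt).const_sub 1
  have hd : deriv (fun t => 1 - ∫ x in a..t, ψ x) = fun t => -ψ t := funext fun t => (hη t).deriv
  have htot : ∫ x in a..b, ψ x = 1 := by
    rw [intervalIntegral.integral_of_le hab.le, setIntegral_eq_integral_of_forall_compl_eq_zero]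
    · exact φ.integral_normed
    · intro t ht
      exact hψ0 t fun h => ht ⟨h.1, h.2.le⟩
  refine ⟨fun t => 1 - ∫ x in a..t, ψ x, ?_, ?_, ?_, ?_, ?_⟩
  · rw [contDiff_infty_iff_deriv]
    refine ⟨fun t => (hη t).differentiableAt, ?_⟩
    rw [hd]
    exact φ.contDiff_normed.neg
  · intro t ht
    have : ∫ x in a..t, ψ x = 0 := by
      rw [intervalIntegral.integral_congr (g := fun _ => (0 : ℝ))]
      · simp
      · intro x hx
        rw [Set.uIcc_of_ge ht] at hx
        exact hψ0 x fun h => absurd h.1 (not_lt.2 hx.2)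
    simp [this]
  · intro t ht
    have : ∫ x in b..t, ψ x = 0 := by
      rw [intervalIntegral.integral_congr (g := fun _ => (0 : ℝ))]
      · simp
      · intro x hx
        rw [Set.uIcc_of_le ht] at hx
        exact hψ0 x fun h => absurd h.2 (not_lt.2 hx.1)
    have h2 := intervalIntegral.integral_add_adjacent_intervals
      (hψc.intervalIntegrable (μ := volume) a b) (hψc.intervalIntegrable b t)
    simp only
    linarith
  · intro t ht
    rw [hd]
    simp [hψ0 t fun h => absurd h.2 (not_lt.2 ht)]
  · intro t
    rw [hd]
    simp only [abs_neg]
    rw [abs_of_nonneg (φ.nonneg_normed t)]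
    refine (φ.normed_le_div_measure_closedBall_rIn volume t).trans (le_of_eq ?_)
    change 1 / volume.real (Metric.closedBall ((a + b) / 2) (3 / 4 * ((b - a) / 2))) = _
    rw [Real.volume_real_closedBall (by positivity)]
    field_simp

theorem bump_exists {d : ℕ} (hd : 2 ≤ d) (x0 : Euc d) (ρ : ℝ) (hρ : 0 < ρ) :
    ∃ f : Euc d → ℝ, ContDiff ℝ (⊤ : ℕ∞) f ∧
      (∀ x, ‖x - x0‖ ≤ (1 - 1 / (2 * d)) * ρ → f x = 1) ∧
      (∀ x, ρ ≤ ‖x - x0‖ → f x = 0 ∧ fderiv ℝ f x = 0) ∧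
      ∀ x, ‖fderiv ℝ f x‖ ≤ (64 / 21) * d / ρ := by
  have hd' : (2 : ℝ) ≤ d := by exact_mod_cast hd
  have hinv : 1 / (2 * (d : ℝ)) ≤ 1 / 4 := by
    apply one_div_le_one_div_of_le <;> linarith
  have hinv0 : 0 < 1 / (2 * (d : ℝ)) := by positivity
  set τ : ℝ := 1 - 1 / (2 * d) with hτ
  have hgap : (7 / 8) * ρ ^ 2 / d ≤ ρ ^ 2 - (τ * ρ) ^ 2 := by
    have e : (7 / 8) * ρ ^ 2 / d = ρ ^ 2 * (7 / 4 * (1 / (2 * (d : ℝ)))) := by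
      field_simp; ring
    have e2 : ρ ^ 2 - (τ * ρ) ^ 2 = ρ ^ 2 * (1 - τ ^ 2) := by ring
    rw [e, e2]
    gcongr
    rw [hτ]
    nlinarith
  have hgap0 : 0 < (7 / 8) * ρ ^ 2 / d := by positivity
  obtain ⟨η, hη, h1, h0, hd0, hb⟩ := cutoff_exists ((τ * ρ) ^ 2) (ρ ^ 2) (by linarith)
  have hfd : ∀ x, HasFDerivAt (fun x : Euc d => η (‖x - x0‖ ^ 2))
      (deriv η (‖x - x0‖ ^ 2) • ((2 : ℝ) • (innerSL ℝ (x - x0)))) x := by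
    intro x
    have k1 : HasFDerivAt (fun x : Euc d => ‖x - x0‖ ^ 2) ((2 : ℝ) • (innerSL ℝ (x - x0))) x := by
      have := ((hasFDerivAt_id x).sub_const x0).norm_sq
      refine this.congr_fderiv ?_
      ext y
      simp [two_smul]
    exact ((hη.differentiable (by simp) _).hasDerivAt).comp_hasFDerivAt x k1
  refine ⟨fun x => η (‖x - x0‖ ^ 2), ?_, ?_, ?_, ?_⟩
  · exact hη.comp ((contDiff_id.sub contDiff_const).norm_sq ℝ)
  · intro x hx
    apply h1
    gcongr
  · intro x hx
    have : ρ ^ 2 ≤ ‖x - x0‖ ^ 2 := by gcongr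
    refine ⟨h0 _ this, ?_⟩
    rw [(hfd x).fderiv, hd0 _ this, zero_smul]
  · intro x
    rw [(hfd x).fderiv]
    by_cases hx : ρ ≤ ‖x - x0‖
    · have : ρ ^ 2 ≤ ‖x - x0‖ ^ 2 := by gcongr
      rw [hd0 _ this, zero_smul, norm_zero]
      positivity
    · push Not at hx
      rw [norm_smul, norm_smul, innerSL_apply_norm, Real.norm_ofNat, Real.norm_eq_abs]
      calc |deriv η (‖x - x0‖ ^ 2)| * (2 * ‖x - x0‖)
          ≤ (4 / 3) / (ρ ^ 2 - (τ * ρ) ^ 2) * (2 * ρ) := by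
            have := hb (‖x - x0‖ ^ 2)
            gcongr
            exact div_nonneg (by norm_num) (by linarith)
        _ ≤ (4 / 3) / ((7 / 8) * ρ ^ 2 / d) * (2 * ρ) := by gcongr
        _ = (64 / 21) * d / ρ := by field_simp; norm_num

theorem vol_compare {d : ℕ} (hd : 2 ≤ d) (Ω : Set (Euc d)) (hΩ : Convex ℝ Ω) (x0 : Euc d)
    (hx0 : x0 ∈ Ω) (ρ : ℝ) :
    volume (Ω ∩ Metric.ball x0 ρ) ≤
      2 * volume (Ω ∩ Metric.closedBall x0 ((1 - 1 / (2 * d)) * ρ)) := by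
  have hd' : (2 : ℝ) ≤ d := by exact_mod_cast hd
  have hinv : 1 / (2 * (d : ℝ)) ≤ 1 / 4 := by
    apply one_div_le_one_div_of_le <;> linarith
  have hinv0 : 0 < 1 / (2 * (d : ℝ)) := by positivity
  set τ : ℝ := 1 - 1 / (2 * d) with hτ
  have hsub : AffineMap.homothety x0 τ '' (Ω ∩ Metric.ball x0 ρ) ⊆
      Ω ∩ Metric.closedBall x0 (τ * ρ) := by
    rintro _ ⟨y, ⟨hy1, hy2⟩, rfl⟩
    have e : AffineMap.homothety x0 τ y = (1 - τ) • x0 + τ • y := by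
      simp [AffineMap.homothety_apply, smul_sub, sub_smul]; abel
    constructor
    · rw [e]
      exact hΩ hx0 hy1 (by linarith) (by linarith) (by ring)
    · rw [Metric.mem_closedBall, dist_eq_norm]
      have : AffineMap.homothety x0 τ y - x0 = τ • (y - x0) := by
        simp [AffineMap.homothety_apply]
      rw [this, norm_smul, Real.norm_eq_abs, abs_of_nonneg (by linarith)]
      rw [Metric.mem_ball, dist_eq_norm] at hy2
      have : 0 ≤ τ := by linarith
      gcongr
  have h1 := measure_mono (μ := volume) hsub
  rw [Measure.addHaar_image_homothety] at h1
  have hb : (1 / 2 : ℝ) ≤ |τ ^ Module.finrank ℝ (Euc d)| := by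
    rw [finrank_euclideanSpace_fin]
    have := one_add_mul_le_pow (a := -(1 / (2 * (d : ℝ)))) (by linarith) d
    have e : 1 + (d : ℝ) * -(1 / (2 * (d : ℝ))) = 1 / 2 := by field_simp; norm_num
    rw [e] at this
    refine le_trans ?_ (le_abs_self _)
    rw [hτ, sub_eq_add_neg]
    exact this
  calc volume (Ω ∩ Metric.ball x0 ρ)
      = 2 * (ENNReal.ofReal (1 / 2) * volume (Ω ∩ Metric.ball x0 ρ)) := by
        rw [← mul_assoc]
        have : (2 : ENNReal) * ENNReal.ofReal (1 / 2) = 1 := by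
          rw [show (2 : ENNReal) = ENNReal.ofReal 2 by simp, ← ENNReal.ofReal_mul (by norm_num)]
          norm_num
        rw [this, one_mul]
    _ ≤ 2 * (ENNReal.ofReal |τ ^ Module.finrank ℝ (Euc d)| * volume (Ω ∩ Metric.ball x0 ρ)) := by
        gcongr
    _ ≤ _ := by gcongr

theorem bump_rayleigh {d : ℕ} (hd : 2 ≤ d) (Ω : Set (Euc d)) (hΩ : Convex ℝ Ω) (hm : MeasurableSet Ω)
    (hbd : Bornology.IsBounded Ω) (x0 : Euc d) (hx0 : x0 ∈ Ω) (R : ℝ) (hR : 0 < R) :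
    ∃ f : Euc d → ℝ, ContDiff ℝ (⊤ : ℕ∞) f ∧ f x0 = 1 ∧
      (∀ x, R / 2 ≤ ‖x - x0‖ → f x = 0 ∧ fderiv ℝ f x = 0) ∧
      ∫ x in Ω, ‖fderiv ℝ f x‖ ^ 2 ≤ 75 * d ^ 2 / R ^ 2 * ∫ x in Ω, f x ^ 2 := by
  have hd' : (2 : ℝ) ≤ d := by exact_mod_cast hd
  obtain ⟨f, hf, h1, h0, hb⟩ := bump_exists hd x0 (R / 2) (by positivity)
  have hinv : 1 / (2 * (d : ℝ)) ≤ 1 / 4 := by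
    apply one_div_le_one_div_of_le <;> linarith
  have hcf : Continuous f := hf.continuous
  have hcg : Continuous (fderiv ℝ f) := hf.continuous_fderiv (by simp)
  obtain ⟨D, hD⟩ := hbd.subset_closedBall x0
  refine ⟨f, hf, h1 _ ?_, h0, ?_⟩
  · simp only [sub_self, norm_zero]
    have : 0 ≤ 1 - 1 / (2 * (d : ℝ)) := by linarith
    positivity
  have hfin : ∀ S ⊆ Ω, volume S ≠ ⊤ := fun S hS =>
    (hbd.subset hS).measure_lt_top.ne
  set M := (64 / 21) * (d : ℝ) / (R / 2) with hM
  set S1 := Ω ∩ Metric.ball x0 (R / 2)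
  set S2 := Ω ∩ Metric.closedBall x0 ((1 - 1 / (2 * d)) * (R / 2))
  have hvol : volume.real S1 ≤ 2 * volume.real S2 := by
    have := vol_compare hd Ω hΩ x0 hx0 (R / 2)
    have h2 := ENNReal.toReal_mono (ENNReal.mul_ne_top (by simp) (hfin _ Set.inter_subset_left)) this
    rw [ENNReal.toReal_mul] at h2
    exact h2
  have ms1 : MeasurableSet S1 := hm.inter measurableSet_ball
  have ms2 : MeasurableSet S2 := hm.inter measurableSet_closedBall
  have up : ∫ x in Ω, ‖fderiv ℝ f x‖ ^ 2 ≤ M ^ 2 * volume.real S1 := by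
    calc ∫ x in Ω, ‖fderiv ℝ f x‖ ^ 2 = ∫ x in S1, ‖fderiv ℝ f x‖ ^ 2 := by
          apply setIntegral_eq_of_subset_of_forall_sdiff_eq_zero hm Set.inter_subset_left
          intro x hx
          have : R / 2 ≤ ‖x - x0‖ := by
            by_contra hc
            push Not at hc
            exact hx.2 ⟨hx.1, by rwa [Metric.mem_ball, dist_eq_norm]⟩
          rw [(h0 x this).2]; simp
      _ ≤ ∫ x in S1, M ^ 2 := by
          apply setIntegral_mono_on (intOn (Set.inter_subset_left.trans hD) (by fun_prop))
            (intOn (Set.inter_subset_left.trans hD) (by fun_prop)) ms1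
          intro x _
          have := hb x
          gcongr
      _ = _ := by rw [setIntegral_const, smul_eq_mul, mul_comm]
  have lo : volume.real S2 ≤ ∫ x in Ω, f x ^ 2 := by
    calc volume.real S2 = ∫ x in S2, f x ^ 2 := by
          rw [setIntegral_congr_fun (g := fun _ => (1 : ℝ)) ms2]
          · simp
          · intro x hx
            have := h1 x (by rw [← dist_eq_norm]; exact hx.2)
            simp [this]
      _ ≤ _ := by
          apply setIntegral_mono_set (intOn hD (by fun_prop)) (ae_of_all _ fun x => sq_nonneg _)
          exact Set.inter_subset_left.eventuallyLE
  calc _ ≤ M ^ 2 * volume.real S1 := up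
    _ ≤ M ^ 2 * (2 * ∫ x in Ω, f x ^ 2) := by
        gcongr
        linarith
    _ = (8 * (64 / 21) ^ 2) * d ^ 2 / R ^ 2 * ∫ x in Ω, f x ^ 2 := by
        rw [hM]; field_simp; ring
    _ ≤ _ := by
        have : 0 ≤ ∫ x in Ω, f x ^ 2 := integral_nonneg fun x => sq_nonneg _
        gcongr
        norm_num

theorem test_space {d : ℕ} (hd : 2 ≤ d) (Ω : Set (Euc d)) (hΩ : Convex ℝ Ω) (hm : MeasurableSet Ω)
    (hbd : Bornology.IsBounded Ω) (k : ℕ) (x : Fin (k + 1) → Euc d) (hx : ∀ i, x i ∈ Ω)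
    (R : ℝ) (hR : 0 < R) (hsep : ∀ i j, i ≠ j → R ≤ dist (x i) (x j)) :
    ∃ V : Submodule ℝ (Euc d → ℝ), (∀ u ∈ V, ContDiff ℝ (⊤ : ℕ∞) u) ∧
      Module.finrank ℝ (V.map (LinearMap.funLeft ℝ ℝ ((↑) : Ω → Euc d))) = k + 1 ∧
      ∀ u ∈ V, ∫ x in Ω, ‖fderiv ℝ u x‖ ^ 2 ≤ 75 * d ^ 2 / R ^ 2 * ∫ x in Ω, u x ^ 2 := by
  choose f hf f1 f0 fr using fun i => bump_rayleigh hd Ω hΩ hm hbd (x i) (hx i) R hR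
  obtain ⟨D, hD⟩ := hbd.subset_closedBall 0
  have hcf : ∀ i, Continuous (f i) := fun i => (hf i).continuous
  have hcg : ∀ i, Continuous (fderiv ℝ (f i)) := fun i => (hf i).continuous_fderiv (by simp)
  -- at each point at most one bump is active
  have one : ∀ y, ∃ i, ∀ j ≠ i, f j y = 0 ∧ fderiv ℝ (f j) y = 0 := by
    intro y
    by_cases h : ∃ i, ‖y - x i‖ < R / 2
    · obtain ⟨i, hi⟩ := h
      refine ⟨i, fun j hj => f0 j y ?_⟩
      have h1 := hsep i j hj.symm
      have h2 := dist_triangle_left (x i) (x j) y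
      rw [dist_eq_norm y, dist_eq_norm y] at h2
      linarith
    · push Not at h
      exact ⟨0, fun j _ => f0 j y (h j)⟩
  have fx : ∀ i j, f i (x j) = if i = j then 1 else 0 := by
    intro i j
    split_ifs with h
    · rw [h, f1]
    · apply (f0 i _ _).1
      have := hsep i j h
      rw [dist_comm, dist_eq_norm] at this
      linarith
  refine ⟨Submodule.span ℝ (Set.range f), ?_, ?_, ?_⟩
  · intro u hu
    rw [Submodule.mem_span_range_iff_exists_fun] at hu
    obtain ⟨c, rfl⟩ := hu
    have : (∑ i, c i • f i) = fun y => ∑ i, c i * f i y := by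
      ext y; simp
    rw [this]
    exact ContDiff.sum fun i _ => contDiff_const.mul (hf i)
  · rw [Submodule.map_span, ← Set.range_comp]
    rw [finrank_span_eq_card]
    · simp
    · rw [Fintype.linearIndependent_iff]
      intro c hc i
      have := congrFun hc ⟨x i, hx i⟩
      simpa [LinearMap.funLeft_apply, fx] using this
  · intro u hu
    rw [Submodule.mem_span_range_iff_exists_fun] at hu
    obtain ⟨c, rfl⟩ := hu
    have e1 : ∀ y, (∑ i, c i • f i) y ^ 2 = ∑ i, c i ^ 2 * f i y ^ 2 := by
      intro y
      obtain ⟨i, hi⟩ := one y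
      rw [Finset.sum_apply, Finset.sum_eq_single i, Finset.sum_eq_single i]
      · simp [mul_pow]
      · intro j _ hj; simp [(hi j hj).1]
      · simp
      · intro j _ hj; simp [(hi j hj).1]
      · simp
    have e2 : ∀ y, ‖fderiv ℝ (∑ i, c i • f i) y‖ ^ 2 = ∑ i, c i ^ 2 * ‖fderiv ℝ (f i) y‖ ^ 2 := by
      intro y
      obtain ⟨i, hi⟩ := one y
      have : fderiv ℝ (∑ i, c i • f i) y = ∑ i, c i • fderiv ℝ (f i) y := by
        apply HasFDerivAt.fderiv
        apply HasFDerivAt.sum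
        intro i _
        exact (((hf i).differentiable (by simp)) y).hasFDerivAt.const_smul (c i)
      rw [this, Finset.sum_eq_single i, Finset.sum_eq_single i]
      · simp [norm_smul, mul_pow]
      · intro j _ hj; simp [(hi j hj).2]
      · simp
      · intro j _ hj; simp [(hi j hj).2]
      · simp
    simp_rw [e1, e2]
    rw [integral_finsetSum _ fun i _ => (intOn hD (by have := hcf i; have := hcg i; fun_prop)),
      integral_finsetSum _ fun i _ => (intOn hD (by have := hcf i; have := hcg i; fun_prop)),
      Finset.mul_sum]
    apply Finset.sum_le_sum
    intro i _
    rw [integral_const_mul, integral_const_mul]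
    have := mul_le_mul_of_nonneg_left (fr i) (sq_nonneg (c i))
    linarith


theorem convex_closer {d : ℕ} (a b : Euc d) :
    Convex ℝ {y : Euc d | dist y a < dist y b} ∧ Convex ℝ {y : Euc d | dist y a ≤ dist y b} := by
  have lin : IsLinearMap ℝ (fun y : Euc d => inner ℝ (b - a) y) :=
    (innerSL ℝ (b - a)).toLinearMap.isLinear
  have key : ∀ y : Euc d, dist y b ^ 2 - dist y a ^ 2
      = ‖b‖ ^ 2 - ‖a‖ ^ 2 - 2 * inner ℝ (b - a) y := by
    intro y
    rw [dist_eq_norm, dist_eq_norm, norm_sub_sq_real, norm_sub_sq_real, inner_sub_left,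
      real_inner_comm y b, real_inner_comm y a]
    ring
  constructor
  · have hset : {y : Euc d | dist y a < dist y b}
        = {y : Euc d | inner ℝ (b - a) y < (‖b‖ ^ 2 - ‖a‖ ^ 2) / 2} := by
      refine Set.ext fun y => ?_
      change dist y a < dist y b ↔ inner ℝ (b - a) y < (‖b‖ ^ 2 - ‖a‖ ^ 2) / 2
      rw [← sq_lt_sq₀ dist_nonneg dist_nonneg, lt_div_iff₀ two_pos]
      have := key y
      constructor <;> intro h <;> linarith
    rw [hset]
    exact convex_halfSpace_lt lin _
  · have hset : {y : Euc d | dist y a ≤ dist y b}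
        = {y : Euc d | inner ℝ (b - a) y ≤ (‖b‖ ^ 2 - ‖a‖ ^ 2) / 2} := by
      refine Set.ext fun y => ?_
      change dist y a ≤ dist y b ↔ inner ℝ (b - a) y ≤ (‖b‖ ^ 2 - ‖a‖ ^ 2) / 2
      rw [← sq_le_sq₀ dist_nonneg dist_nonneg, le_div_iff₀ two_pos]
      have := key y
      constructor <;> intro h <;> linarith
    rw [hset]
    exact convex_halfSpace_le lin _

/-- Voronoi cells with tie-breaking. -/
def vcell {d l : ℕ} (Ω : Set (Euc d)) (x : Fin l → Euc d) (i : Fin l) : Set (Euc d) :=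
  Ω ∩ ((⋂ j : Fin l, ⋂ _ : j < i, {y | dist y (x i) < dist y (x j)}) ∩
    (⋂ j : Fin l, ⋂ _ : i < j, {y | dist y (x i) ≤ dist y (x j)}))

theorem mem_vcell {d l : ℕ} (Ω : Set (Euc d)) (x : Fin l → Euc d) (i : Fin l) (y : Euc d) :
    y ∈ vcell Ω x i ↔ y ∈ Ω ∧ (∀ j < i, dist y (x i) < dist y (x j)) ∧
      ∀ j, i < j → dist y (x i) ≤ dist y (x j) := by
  simp [vcell]

theorem voronoi_poincare {d l : ℕ} (Ω : Set (Euc d)) (hΩ : Convex ℝ Ω) (hm : MeasurableSet Ω)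
    (x : Fin l → Euc d) (r : ℝ) (hr : 0 < r) (hbd : Bornology.IsBounded Ω)
    (hcov : ∀ y ∈ Ω, ∃ i, dist y (x i) < r) (u : Euc d → ℝ) (hu : ContDiff ℝ 2 u)
    (hmean : ∀ i, ∫ y in vcell Ω x i, u y * gw (x i) (r ^ 2) y = 0) :
    ∫ y in Ω, u y ^ 2 ≤ 16 * r ^ 2 * ∫ y in Ω, ‖fderiv ℝ u y‖ ^ 2 := by
  have hcu : Continuous u := hu.continuous
  have hcg : Continuous (fderiv ℝ u) := hu.continuous_fderiv (by norm_num)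
  obtain ⟨D, hD⟩ := hbd.subset_closedBall 0
  have hsub : ∀ i, vcell Ω x i ⊆ Ω := fun i => Set.inter_subset_left
  have hmeas : ∀ i, MeasurableSet (vcell Ω x i) := by
    intro i
    refine hm.inter ((MeasurableSet.iInter fun j => MeasurableSet.iInter fun _ => ?_).inter
      (MeasurableSet.iInter fun j => MeasurableSet.iInter fun _ => ?_))
    · exact measurableSet_lt (by fun_prop) (by fun_prop)
    · exact measurableSet_le (by fun_prop) (by fun_prop)
  have hconv : ∀ i, Convex ℝ (vcell Ω x i) := by
    intro i
    refine hΩ.inter ((convex_iInter fun j => convex_iInter fun _ => ?_).inter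
      (convex_iInter fun j => convex_iInter fun _ => ?_))
    · exact (convex_closer _ _).1
    · exact (convex_closer _ _).2
  have hle : ∀ i, ∀ y ∈ vcell Ω x i, ∀ j, dist y (x i) ≤ dist y (x j) := by
    intro i y hy j
    rw [mem_vcell] at hy
    rcases lt_trichotomy j i with h | h | h
    · exact (hy.2.1 j h).le
    · rw [h]
    · exact hy.2.2 j h
  have hball : ∀ i, vcell Ω x i ⊆ Metric.closedBall (x i) r := by
    intro i y hy
    obtain ⟨j, hj⟩ := hcov y (hsub i hy)
    exact (hle i y hy j).trans hj.le
  have hdisj : Pairwise (Function.onFun Disjoint (vcell Ω x)) := by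
    intro i j hij
    rw [Function.onFun, Set.disjoint_left]
    intro y hi hj
    rw [mem_vcell] at hi hj
    rcases lt_or_gt_of_ne hij with h | h
    · exact absurd (hj.2.1 i h) (not_lt.2 (hi.2.2 j h))
    · exact absurd (hi.2.1 j h) (not_lt.2 (hj.2.2 i h))
  have hunion : Ω = ⋃ i, vcell Ω x i := by
    apply Set.Subset.antisymm
    · intro y hy
      have hne : Nonempty (Fin l) := ⟨(hcov y hy).choose⟩
      obtain ⟨i, hi⟩ := Finite.exists_min (fun i : Fin l => toLex (dist y (x i), i))
      rw [Set.mem_iUnion]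
      refine ⟨i, (mem_vcell _ _ _ _).2 ⟨hy, ?_, ?_⟩⟩
      · intro j hj
        have := hi j
        rw [Prod.Lex.le_iff] at this
        rcases this with h | h
        · exact h
        · exact absurd h.2 (not_le.2 hj)
      · intro j hj
        have := hi j
        rw [Prod.Lex.le_iff] at this
        rcases this with h | h
        · exact h.le
        · exact h.1.le
    · exact Set.iUnion_subset hsub
  have split : ∀ F : Euc d → ℝ, Continuous F → ∫ y in Ω, F y = ∑ i, ∫ y in vcell Ω x i, F y := by
    intro F hF
    conv_lhs => rw [hunion]
    exact integral_iUnion_fintype hmeas hdisj fun i => intOn ((hsub i).trans hD) hF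
  rw [split _ (by fun_prop), split _ (by fun_prop), Finset.mul_sum]
  apply Finset.sum_le_sum
  intro i _
  exact poincare _ (hmeas i) (hconv i) (x i) r hr (hball i) u hu (hmean i)

/-- `n` points of `Ω` that are pairwise `r`-separated. -/
def HasSep {d : ℕ} (Ω : Set (Euc d)) (n : ℕ) (r : ℝ) : Prop :=
  ∃ x : Fin n → Euc d, (∀ i, x i ∈ Ω) ∧ ∀ i j, i ≠ j → r ≤ dist (x i) (x j)

theorem exists_scale {d : ℕ} (hd : 2 ≤ d) (k : ℕ) (hk : 1 ≤ k) (Ω : Set (Euc d))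
    (hne : Ω.Nonempty) (ho : IsOpen Ω) (hbd : Bornology.IsBounded Ω) :
    ∃ R : ℝ, 0 < R ∧ HasSep Ω (k + 1) R ∧ ¬ HasSep Ω (k + 1) (2 * R) := by
  classical
  have : Nonempty (Fin d) := ⟨⟨0, by omega⟩⟩
  obtain ⟨y, hy⟩ := hne
  have hinf : Ω.Infinite := infinite_of_mem_nhds y (ho.mem_nhds hy)
  set x : Fin (k + 1) → Euc d := fun i => (hinf.natEmbedding Ω i.1 : Euc d)
  have hxinj : Function.Injective x := by
    intro i j h
    exact Fin.ext ((hinf.natEmbedding Ω).injective (Subtype.ext h))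
  have hx : ∀ i, x i ∈ Ω := fun i => (hinf.natEmbedding Ω i.1).2
  have i0 : (⟨0, by omega⟩ : Fin (k + 1)) ≠ ⟨1, by omega⟩ := by simp
  have hP : Nonempty {p : Fin (k + 1) × Fin (k + 1) // p.1 ≠ p.2} :=
    ⟨⟨(⟨0, by omega⟩, ⟨1, by omega⟩), i0⟩⟩
  obtain ⟨p, hp⟩ := Finite.exists_min
    (fun p : {p : Fin (k + 1) × Fin (k + 1) // p.1 ≠ p.2} => dist (x p.1.1) (x p.1.2))
  set r0 := dist (x p.1.1) (x p.1.2) with hr0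
  have r0pos : 0 < r0 := dist_pos.2 fun h => p.2 (hxinj h)
  have h0 : HasSep Ω (k + 1) r0 := ⟨x, hx, fun i j hij => hp ⟨(i, j), hij⟩⟩
  have hfail : ∃ n : ℕ, ¬ HasSep Ω (k + 1) (2 ^ n * r0) := by
    obtain ⟨n, hn⟩ := pow_unbounded_of_one_lt (Metric.diam Ω / r0) (one_lt_two)
    refine ⟨n, ?_⟩
    rintro ⟨z, hz, hs⟩
    have h1 := hs _ _ i0
    have h2 := Metric.dist_le_diam_of_mem hbd (hz ⟨0, by omega⟩) (hz ⟨1, by omega⟩)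
    rw [div_lt_iff₀ r0pos] at hn
    linarith
  have hn := Nat.find_spec hfail
  have hmin := fun m => Nat.find_min (H := hfail) (m := m)
  generalize Nat.find hfail = n at hn hmin
  cases n with
  | zero => exact absurd h0 (by simpa using hn)
  | succ n =>
    refine ⟨2 ^ n * r0, by positivity, not_not.1 (hmin n (by omega)), ?_⟩
    rwa [← mul_assoc, ← pow_succ']

theorem exists_cover {d : ℕ} (k : ℕ) (Ω : Set (Euc d)) (r : ℝ)
    (h : ¬ HasSep Ω (k + 1) r) :
    ∃ l ≤ k, ∃ x : Fin l → Euc d, ∀ y ∈ Ω, ∃ i, dist y (x i) < r := by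
  classical
  have hfail : ∃ n, ¬ HasSep Ω n r := ⟨_, h⟩
  have hle : Nat.find hfail ≤ k + 1 := Nat.find_min' _ h
  have hn := Nat.find_spec hfail
  have hmin := fun m => Nat.find_min (H := hfail) (m := m)
  generalize Nat.find hfail = n at hn hmin hle
  cases n with
  | zero => exact absurd ⟨Fin.elim0, fun i => i.elim0, fun i => i.elim0⟩ hn
  | succ l =>
    obtain ⟨x, hx, hs⟩ := not_not.1 (hmin l (by omega))
    refine ⟨l, by omega, x, ?_⟩
    intro y hy
    by_contra hc
    push Not at hc
    apply hn
    refine ⟨Fin.cons y x, ?_, ?_⟩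
    · intro i
      refine Fin.cases ?_ (fun j => ?_) i
      · simpa using hy
      · simpa using hx j
    · intro i j
      refine Fin.cases ?_ (fun i => ?_) i <;> refine Fin.cases ?_ (fun j => ?_) j
      · simp
      · intro _; simpa using hc j
      · intro _; simpa [dist_comm] using hc i
      · intro hij
        simpa using hs i j (fun e => hij (by rw [e]))

theorem exists_basis_lift {d k : ℕ} (Ω : Set (Euc d)) (V : Submodule ℝ (Euc d → ℝ))
    (hfr : Module.finrank ℝ (V.map (LinearMap.funLeft ℝ ℝ ((↑) : Ω → Euc d))) = k + 1) :
    ∃ e : Fin (k + 1) → Euc d → ℝ, (∀ j, e j ∈ V) ∧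
      (∀ u ∈ V, ∃ c : Fin (k + 1) → ℝ, ∀ y ∈ Ω, u y = (∑ j, c j • e j) y) ∧
      ∀ c : Fin (k + 1) → ℝ, (∀ y ∈ Ω, (∑ j, c j • e j) y = 0) → c = 0 := by
  set T := LinearMap.funLeft ℝ ℝ ((↑) : Ω → Euc d) with hT
  have hfin : Module.Finite ℝ (V.map T) := Module.finite_of_finrank_pos (by omega)
  set b := Module.finBasisOfFinrankEq ℝ (V.map T) hfr
  have hb : ∀ j, ∃ e ∈ V, T e = (b j : Ω → ℝ) := fun j => (Submodule.mem_map).1 (b j).2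
  choose e heV heT using hb
  have hsum : ∀ c : Fin (k + 1) → ℝ, T (∑ j, c j • e j) = ((∑ j, c j • b j : V.map T) : Ω → ℝ) := by
    intro c
    rw [map_sum]
    simp [heT]
  refine ⟨e, heV, ?_, ?_⟩
  · intro u hu
    set w : V.map T := ⟨T u, Submodule.mem_map_of_mem hu⟩
    refine ⟨fun j => b.repr w j, fun y hy => ?_⟩
    have h1 := hsum fun j => b.repr w j
    rw [b.sum_repr w] at h1
    exact (congrFun h1 ⟨y, hy⟩).symm
  · intro c hc
    have h1 : ∑ j, c j • b j = 0 := by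
      apply Subtype.ext
      rw [← hsum]
      ext y
      exact hc y y.2
    ext j
    exact Fintype.linearIndependent_iff.1 b.linearIndependent c h1 j

theorem int_sq_pos {d : ℕ} (Ω : Set (Euc d)) (ho : IsOpen Ω) (hbd : Bornology.IsBounded Ω)
    (u : Euc d → ℝ) (hu : Continuous u) (y : Euc d) (hy : y ∈ Ω) (hne : u y ≠ 0) :
    0 < ∫ x in Ω, u x ^ 2 := by
  obtain ⟨D, hD⟩ := hbd.subset_closedBall 0
  rw [setIntegral_pos_iff_support_of_nonneg_ae (ae_of_all _ fun x => sq_nonneg _)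
    (intOn hD (by fun_prop))]
  have hop : IsOpen (Function.support (fun x => u x ^ 2) ∩ Ω) :=
    (hu.pow 2).isOpen_support.inter ho
  exact hop.measure_pos volume ⟨y, by simpa using hne, hy⟩

theorem comb_smooth {d k : ℕ} (V : Submodule ℝ (Euc d → ℝ))
    (e : Fin (k + 1) → Euc d → ℝ) (he : ∀ j, e j ∈ V) (c : Fin (k + 1) → ℝ) :
    (∑ j, c j • e j) ∈ V :=
  V.sum_mem fun j _ => V.smul_mem _ (he j)

theorem rayleigh_bdd {d k : ℕ} (Ω : Set (Euc d)) (ho : IsOpen Ω) (hbd : Bornology.IsBounded Ω)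
    (V : Submodule ℝ (Euc d → ℝ)) (hV : ∀ u ∈ V, ContDiff ℝ (⊤ : ℕ∞) u)
    (hfr : Module.finrank ℝ (V.map (LinearMap.funLeft ℝ ℝ ((↑) : Ω → Euc d))) = k + 1) :
    ∃ B : ℝ, ∀ u ∈ V, ∫ x in Ω, ‖fderiv ℝ u x‖ ^ 2 ≤ B * ∫ x in Ω, u x ^ 2 := by
  obtain ⟨e, heV, hspan, hind⟩ := exists_basis_lift Ω V hfr
  obtain ⟨D, hD⟩ := hbd.subset_closedBall 0
  have hce : ∀ j, Continuous (e j) := fun j => (hV _ (heV j)).continuous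
  have hcg : ∀ j, Continuous (fderiv ℝ (e j)) := fun j =>
    (hV _ (heV j)).continuous_fderiv (by simp)
  set N : (Fin (k + 1) → ℝ) → ℝ := fun c => ∫ x in Ω, (∑ j, c j • e j) x ^ 2 with hN
  have hNexp : N = fun c => ∑ i, ∑ j, c i * c j * ∫ x in Ω, e i x * e j x := by
    ext c
    have h1 : ∀ x, (∑ j, c j • e j) x ^ 2 = ∑ i, ∑ j, c i * c j * (e i x * e j x) := by
      intro x
      rw [sq, Finset.sum_apply, Finset.sum_mul_sum]
      refine Finset.sum_congr rfl fun i _ => Finset.sum_congr rfl fun j _ => ?_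
      simp only [Pi.smul_apply, smul_eq_mul]; ring
    simp only [hN]
    simp_rw [h1]
    rw [integral_finsetSum _ fun i _ => intOn hD (by have := hce i; fun_prop)]
    refine Finset.sum_congr rfl fun i _ => ?_
    rw [integral_finsetSum _ fun j _ => intOn hD (by have := hce i; have := hce j; fun_prop)]
    refine Finset.sum_congr rfl fun j _ => ?_
    rw [integral_const_mul]
  have hNc : Continuous N := by rw [hNexp]; fun_prop
  have hNpos : ∀ c, c ≠ 0 → 0 < N c := by
    intro c hc
    have : ∃ y ∈ Ω, (∑ j, c j • e j) y ≠ 0 := by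
      by_contra h
      push Not at h
      exact hc (hind c h)
    obtain ⟨y, hy, hne⟩ := this
    exact int_sq_pos Ω ho hbd _ (hV _ (comb_smooth V e heV c)).continuous y hy hne
  obtain ⟨c0, hc0, hmin⟩ := (isCompact_sphere (0 : Fin (k + 1) → ℝ) 1).exists_isMinOn
    (NormedSpace.sphere_nonempty.2 zero_le_one) hNc.continuousOn
  have hm : 0 < N c0 := hNpos c0 (by
    rintro rfl
    simp at hc0)
  have hNlow : ∀ c, N c0 * ‖c‖ ^ 2 ≤ N c := by
    intro c
    by_cases hc : c = 0
    · subst hc; simp [hN]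
    have hnc : 0 < ‖c‖ := norm_pos_iff.2 hc
    have h1 : N c0 ≤ N (‖c‖⁻¹ • c) := hmin (by simp [norm_smul, hnc.ne'])
    have h2 : N (‖c‖⁻¹ • c) = (‖c‖⁻¹) ^ 2 * N c := by
      rw [hNexp]
      simp only [Finset.mul_sum]
      refine Finset.sum_congr rfl fun i _ => Finset.sum_congr rfl fun j _ => ?_
      simp only [Pi.smul_apply, smul_eq_mul]; ring
    rw [h2] at h1
    calc N c0 * ‖c‖ ^ 2 ≤ (‖c‖⁻¹) ^ 2 * N c * ‖c‖ ^ 2 := by gcongr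
      _ = N c := by field_simp
  set E := ∫ x in Ω, (∑ j, ‖fderiv ℝ (e j) x‖) ^ 2 with hE
  have hE0 : 0 ≤ E := integral_nonneg fun x => sq_nonneg _
  refine ⟨E / N c0, ?_⟩
  intro u hu
  obtain ⟨c, hc⟩ := hspan u hu
  have e1 : ∫ x in Ω, u x ^ 2 = N c := setIntegral_congr_fun ho.measurableSet fun x hx => by
    change u x ^ 2 = (∑ j, c j • e j) x ^ 2
    rw [hc x hx]
  have e2 : ∫ x in Ω, ‖fderiv ℝ u x‖ ^ 2 ≤ ‖c‖ ^ 2 * E := by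
    rw [hE, ← integral_const_mul]
    have hcu : Continuous (fderiv ℝ u) := (hV u hu).continuous_fderiv (by simp)
    apply setIntegral_mono_on (intOn hD (by fun_prop)) (intOn hD (by fun_prop)) ho.measurableSet
    intro x hx
    have h1 : fderiv ℝ u x = ∑ j, c j • fderiv ℝ (e j) x := by
      have : u =ᶠ[nhds x] (∑ j, c j • e j) := by
        filter_upwards [ho.mem_nhds hx] with y hy using hc y hy
      rw [this.fderiv_eq]
      apply HasFDerivAt.fderiv
      apply HasFDerivAt.sum
      intro i _
      exact (((hV _ (heV i)).differentiable (by simp)) x).hasFDerivAt.const_smul (c i)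
    rw [h1, ← mul_pow]
    gcongr
    calc ‖∑ j, c j • fderiv ℝ (e j) x‖ ≤ ∑ j, ‖c j • fderiv ℝ (e j) x‖ := norm_sum_le _ _
      _ ≤ ∑ j, ‖c‖ * ‖fderiv ℝ (e j) x‖ := by
          apply Finset.sum_le_sum
          intro j _
          rw [norm_smul]
          gcongr
          exact norm_le_pi_norm c j
      _ = _ := by rw [Finset.mul_sum]
  rw [e1]
  calc _ ≤ ‖c‖ ^ 2 * E := e2
    _ = E / N c0 * (N c0 * ‖c‖ ^ 2) := by field_simp
    _ ≤ _ := by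
      have := hNlow c
      gcongr

theorem exists_good {d k l : ℕ} (hl : l ≤ k) (Ω : Set (Euc d)) (hΩ : Convex ℝ Ω) (ho : IsOpen Ω)
    (hbd : Bornology.IsBounded Ω) (x : Fin l → Euc d) (r : ℝ) (hr : 0 < r)
    (hcov : ∀ y ∈ Ω, ∃ i, dist y (x i) < r)
    (V : Submodule ℝ (Euc d → ℝ)) (hV : ∀ u ∈ V, ContDiff ℝ (⊤ : ℕ∞) u)
    (hfr : Module.finrank ℝ (V.map (LinearMap.funLeft ℝ ℝ ((↑) : Ω → Euc d))) = k + 1) :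
    ∃ u ∈ V, 0 < ∫ y in Ω, u y ^ 2 ∧
      ∫ y in Ω, u y ^ 2 ≤ 16 * r ^ 2 * ∫ y in Ω, ‖fderiv ℝ u y‖ ^ 2 := by
  obtain ⟨e, heV, hspan, hind⟩ := exists_basis_lift Ω V hfr
  obtain ⟨D, hD⟩ := hbd.subset_closedBall 0
  have hce : ∀ j, Continuous (e j) := fun j => (hV _ (heV j)).continuous
  set A : Matrix (Fin l) (Fin (k + 1)) ℝ := fun i j =>
    ∫ y in vcell Ω x i, e j y * gw (x i) (r ^ 2) y with hA
  have hker : LinearMap.ker A.mulVecLin ≠ ⊥ := by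
    apply LinearMap.ker_ne_bot_of_finrank_lt
    simp
    omega
  obtain ⟨c, hc, hc0⟩ := (Submodule.ne_bot_iff _).1 hker
  have hu := comb_smooth V e heV c
  refine ⟨_, hu, ?_, ?_⟩
  · have : ∃ y ∈ Ω, (∑ j, c j • e j) y ≠ 0 := by
      by_contra h
      push Not at h
      exact hc0 (hind c h)
    obtain ⟨y, hy, hne⟩ := this
    exact int_sq_pos Ω ho hbd _ (hV _ hu).continuous y hy hne
  · refine voronoi_poincare Ω hΩ ho.measurableSet x r hr hbd hcov _ ((hV _ hu).of_le ?_) ?_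
    · exact WithTop.coe_le_coe.2 le_top
    · intro i
      have h1 : ∀ y, (∑ j, c j • e j) y * gw (x i) (r ^ 2) y
          = ∑ j, c j * (e j y * gw (x i) (r ^ 2) y) := by
        intro y
        rw [Finset.sum_apply, Finset.sum_mul]
        refine Finset.sum_congr rfl fun j _ => ?_
        simp only [Pi.smul_apply, smul_eq_mul]; ring
      simp_rw [h1]
      have hcw := gw_cont (x i) (r ^ 2)
      have hs : vcell Ω x i ⊆ Metric.closedBall 0 D :=
        (Set.inter_subset_left : vcell Ω x i ⊆ Ω).trans hD
      rw [integral_finsetSum _ fun j _ => intOn hs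
        (by have := hce j; fun_prop)]
      have h2 := congrFun (LinearMap.mem_ker.1 hc) i
      simp only [Matrix.mulVecLin_apply, Matrix.mulVec, dotProduct, hA, Pi.zero_apply] at h2
      rw [← h2]
      refine Finset.sum_congr rfl fun j _ => ?_
      rw [integral_const_mul, mul_comm]

theorem rayleigh_nonneg_set {d : ℕ} (Ω : Set (Euc d)) (V : Submodule ℝ (Euc d → ℝ)) :
    0 ≤ sSup { r : ℝ | ∃ u ∈ V, (0 < ∫ x in Ω, (u x) ^ 2) ∧ r = rayleigh Ω u } := by
  apply Real.sSup_nonneg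
  rintro r ⟨u, _, hpos, rfl⟩
  exact div_nonneg (integral_nonneg fun x => sq_nonneg _) hpos.le

theorem neumann_upper {d : ℕ} (hd : 2 ≤ d) (Ω : Set (Euc d)) (h : IsConvexDomain Ω) (k : ℕ)
    (x : Fin (k + 1) → Euc d) (hx : ∀ i, x i ∈ Ω)
    (R : ℝ) (hR : 0 < R) (hsep : ∀ i j, i ≠ j → R ≤ dist (x i) (x j)) :
    neumannEigenvalue k Ω ≤ 75 * d ^ 2 / R ^ 2 := by
  obtain ⟨-, ho, hbd, hc⟩ := h
  obtain ⟨V, hV, hfr, hle⟩ := test_space hd Ω hc ho.measurableSet hbd k x hx R hR hsep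
  unfold neumannEigenvalue
  refine le_trans (csInf_le ?_ ⟨V, hV, hfr, rfl⟩) ?_
  · refine ⟨0, ?_⟩
    rintro t ⟨W, -, -, rfl⟩
    exact rayleigh_nonneg_set Ω W
  · apply Real.sSup_le
    · rintro r ⟨u, hu, hpos, rfl⟩
      rw [rayleigh, div_le_iff₀ hpos]
      exact hle u hu
    · positivity

theorem neumann_lower {d : ℕ} (hd : 2 ≤ d) (Ω : Set (Euc d)) (h : IsConvexDomain Ω) (k : ℕ)
    (x : Fin (k + 1) → Euc d) (hx : ∀ i, x i ∈ Ω)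
    (R : ℝ) (hR : 0 < R) (hsep : ∀ i j, i ≠ j → R ≤ dist (x i) (x j))
    (r : ℝ) (hr : 0 < r) (hns : ¬ HasSep Ω (k + 1) r) :
    1 / (16 * r ^ 2) ≤ neumannEigenvalue k Ω := by
  obtain ⟨-, ho, hbd, hc⟩ := h
  obtain ⟨V, hV, hfr, -⟩ := test_space hd Ω hc ho.measurableSet hbd k x hx R hR hsep
  obtain ⟨l, hl, z, hz⟩ := exists_cover k Ω r hns
  refine le_csInf ⟨_, V, hV, hfr, rfl⟩ ?_
  rintro t ⟨W, hW, hWfr, rfl⟩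
  obtain ⟨B, hB⟩ := rayleigh_bdd Ω ho hbd W hW hWfr
  obtain ⟨u, hu, hpos, hle⟩ := exists_good hl Ω hc ho hbd z r hr hz W hW hWfr
  have h1 : 1 / (16 * r ^ 2) ≤ rayleigh Ω u := by
    rw [rayleigh, div_le_div_iff₀ (by positivity) hpos]
    linarith
  refine h1.trans (le_csSup ⟨B, ?_⟩ ⟨u, hu, hpos, rfl⟩)
  rintro s ⟨v, hv, hvpos, rfl⟩
  rw [rayleigh, div_le_iff₀ hvpos]
  exact hB v hv

/-- Funano's theorem with explicit constant `C = 1/92²`: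
`μ_k(Ω₁) ≥ (C/d²) μ_k(Ω₂)` for nested bounded convex domains. -/
theorem funano_quasi_monotonicity
    (d : ℕ) (hd : 2 ≤ d) (k : ℕ) (hk : 1 ≤ k) (Ω₁ Ω₂ : Set (Euc d))
    (h₁ : IsConvexDomain Ω₁) (h₂ : IsConvexDomain Ω₂) (hsub : Ω₁ ⊆ Ω₂) :
    neumannEigenvalue k Ω₁ ≥
      (1 / 92 ^ 2) / (d : ℝ) ^ 2 * neumannEigenvalue k Ω₂ := by
  obtain ⟨R, hR, ⟨x, hx, hsep⟩, hns⟩ := exists_scale hd k hk Ω₁ h₁.1 h₁.2.1 h₁.2.2.1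
  have hup := neumann_upper hd Ω₂ h₂ k x (fun i => hsub (hx i)) R hR hsep
  have hlow := neumann_lower hd Ω₁ h₁ k x hx R hR hsep (2 * R) (by positivity) hns
  have hd0 : (0 : ℝ) < d := by
    have : 0 < d := by omega
    exact_mod_cast this
  calc (1 / 92 ^ 2) / (d : ℝ) ^ 2 * neumannEigenvalue k Ω₂
      ≤ (1 / 92 ^ 2) / (d : ℝ) ^ 2 * (75 * d ^ 2 / R ^ 2) := by gcongr
    _ = (75 / 92 ^ 2) / R ^ 2 := by field_simp
    _ ≤ (1 / 64) / R ^ 2 :=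
      div_le_div_of_nonneg_right (by norm_num) (by positivity)
    _ = 1 / (16 * (2 * R) ^ 2) := by
      rw [div_div, mul_pow, ← mul_assoc]
      norm_num
    _ ≤ _ := hlow

end
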